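/- Let k be algebraically closed, n ≥ 1, and λ a nonzero element of k. Set C = xI_n + q⁻¹y·J_n(λ) and D = qx·J_n(λ)⁻¹ − qyI_n, as n×n matrices over B. Then ν(C)D = wI_n and DC = wI_n, i.e. (Bⁿ, Bⁿ, ·C, ·D) is a twisted matrix factorization of w; and the image of the induced left A-linear map Aⁿ → Aⁿ given by right multiplication by the reduction of C modulo w is isomorphic as a left A-module to C_n(λ). Hence every C_n(λ) with λ ∉ {0, ∞} lies in the image of the reduction functor from twisted matrix factorizations of w over B to the stable module category of A. -/

import Mathlib

noncomputable section
open FreeAlgebra Matrix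

/-- The defining relations of `B = k⟨x,y⟩/(x², y², xyx, yxy)`. -/
inductive BRel (k : Type*) [Field k] : FreeAlgebra k (Fin 2) → FreeAlgebra k (Fin 2) → Prop
  | xx : BRel k (ι k 0 * ι k 0) 0
  | yy : BRel k (ι k 1 * ι k 1) 0
  | xyx : BRel k (ι k 0 * ι k 1 * ι k 0) 0
  | yxy : BRel k (ι k 1 * ι k 0 * ι k 1) 0

/-- The algebra `B = k⟨x,y⟩/(x², y², xyx, yxy)`. -/
abbrev B (k : Type*) [Field k] := RingQuot (BRel k)

/-- The image of the generator `x` in `B`. -/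
def Bx (k : Type*) [Field k] : B k := RingQuot.mkAlgHom k (BRel k) (ι k 0)

/-- The image of the generator `y` in `B`. -/
def By (k : Type*) [Field k] : B k := RingQuot.mkAlgHom k (BRel k) (ι k 1)

/-- The element `w = xy - q·yx` of `B`. -/
def wB (k : Type*) [Field k] (q : k) : B k := Bx k * By k - q • (By k * Bx k)
set_option maxSynthPendingDepth 3

/-- The relation generating the two-sided ideal `(w)` of `B`. -/
inductive ARel (k : Type*) [Field k] (q : k) : B k → B k → Prop
  | w : ARel k q (wB k q) 0

/-- The quantum complete intersection `A = B/(w)`. -/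
abbrev Aalg (k : Type*) [Field k] (q : k) := RingQuot (ARel k q)

/-- The quotient map `B → A = B/(w)`. -/
def piA (k : Type*) [Field k] (q : k) : B k →ₐ[k] Aalg k q :=
  RingQuot.mkAlgHom k (ARel k q)

/-- The image of `x` in `A`. -/
def Ax (k : Type*) [Field k] (q : k) : Aalg k q := piA k q (Bx k)

/-- The image of `y` in `A`. -/
def Ay (k : Type*) [Field k] (q : k) : Aalg k q := piA k q (By k)

/-- Regard a matrix over `k` as a matrix over `B` via the structure map. -/
def matB (k : Type*) [Field k] {r : ℕ} (M : Matrix (Fin r) (Fin r) k) :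
    Matrix (Fin r) (Fin r) (B k) :=
  M.map (algebraMap k (B k))

/-- Regard a matrix over `k` as a matrix over `A` via the structure map. -/
def matA (k : Type*) [Field k] (q : k) {r : ℕ} (M : Matrix (Fin r) (Fin r) k) :
    Matrix (Fin r) (Fin r) (Aalg k q) :=
  M.map (algebraMap k (Aalg k q))

/-- The `n × n` Jordan block with eigenvalue `l` (`l` on the diagonal, `1` on the
superdiagonal). -/
def jordan (k : Type*) [Field k] (n : ℕ) (l : k) : Matrix (Fin n) (Fin n) k :=
  Matrix.of fun i j => if (j : ℕ) = (i : ℕ) then l else if (j : ℕ) = (i : ℕ) + 1 then 1 else 0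

/-- The image (as a `k`-subspace of `Aⁿ`) of right multiplication of row vectors by a
matrix `M` over `A`. -/
def imageM (k : Type*) [Field k] (q : k) {n : ℕ} (M : Matrix (Fin n) (Fin n) (Aalg k q)) :
    Submodule k (Fin n → Aalg k q) :=
  Submodule.span k (Set.range fun u : Fin n → Aalg k q => u ᵥ* M)

theorem piA_surjective (k : Type*) [Field k] (q : k) : Function.Surjective (piA k q) :=
  RingQuot.mkAlgHom_surjective k (ARel k q)

theorem Bx_mul_Bx (k : Type*) [Field k] : Bx k * Bx k = 0 := by
  simpa [Bx] using RingQuot.mkAlgHom_rel k (BRel.xx (k := k))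

theorem By_mul_By (k : Type*) [Field k] : By k * By k = 0 := by
  simpa [By] using RingQuot.mkAlgHom_rel k (BRel.yy (k := k))

theorem Ax_mul_Ax (k : Type*) [Field k] (q : k) : Ax k q * Ax k q = 0 := by
  rw [Ax, ← map_mul, Bx_mul_Bx, map_zero]

theorem Ay_mul_Ay (k : Type*) [Field k] (q : k) : Ay k q * Ay k q = 0 := by
  rw [Ay, ← map_mul, By_mul_By, map_zero]

theorem Ax_mul_Ay (k : Type*) [Field k] (q : k) :
    Ax k q * Ay k q = q • (Ay k q * Ax k q) := by
  have h : piA k q (wB k q) = 0 := by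
    simpa [piA] using RingQuot.mkAlgHom_rel k (ARel.w (k := k) (q := q))
  rw [wB, map_sub, map_smul, map_mul, map_mul, sub_eq_zero] at h
  exact h

/-- The matrix of left multiplication by `x` on `A` in the basis `1, x, y, yx`. -/
def regX (k : Type*) [Field k] (q : k) : Matrix (Fin 4) (Fin 4) k :=
  !![0, 0, 0, 0; 1, 0, 0, 0; 0, 0, 0, 0; 0, 0, q, 0]

/-- The matrix of left multiplication by `y` on `A` in the basis `1, x, y, yx`. -/
def regY (k : Type*) [Field k] : Matrix (Fin 4) (Fin 4) k :=
  !![0, 0, 0, 0; 0, 0, 0, 0; 1, 0, 0, 0; 0, 1, 0, 0]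

/-- The representation of `B` on `k⁴` inflated from the regular representation of `A`. -/
def regB (k : Type*) [Field k] (q : k) : B k →ₐ[k] Matrix (Fin 4) (Fin 4) k :=
  RingQuot.liftAlgHom k ⟨FreeAlgebra.lift k ![regX k q, regY k], by
    intro a b h
    cases h <;> ext i j <;> fin_cases i <;> fin_cases j <;>
      simp [regX, regY]⟩

theorem regB_Bx (k : Type*) [Field k] (q : k) : regB k q (Bx k) = regX k q := by
  simp [regB, Bx]

theorem regB_By (k : Type*) [Field k] (q : k) : regB k q (By k) = regY k := by
  simp [regB, By]

/-- The regular representation of `A` on `k⁴`. -/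
def regA (k : Type*) [Field k] (q : k) : Aalg k q →ₐ[k] Matrix (Fin 4) (Fin 4) k :=
  RingQuot.liftAlgHom k ⟨regB k q, by
    intro a b h
    cases h
    rw [wB, map_sub, map_smul, map_mul, map_mul, regB_Bx, regB_By]
    ext i j
    fin_cases i <;> fin_cases j <;> simp [regX, regY]⟩

theorem regA_piA (k : Type*) [Field k] (q : k) (b : B k) :
    regA k q (piA k q b) = regB k q b := by
  simp [regA, piA]

theorem regA_Ax (k : Type*) [Field k] (q : k) : regA k q (Ax k q) = regX k q := by
  rw [Ax, regA_piA, regB_Bx]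

theorem regA_Ay (k : Type*) [Field k] (q : k) : regA k q (Ay k q) = regY k := by
  rw [Ay, regA_piA, regB_By]

/-- In a linear relation between `yx`, `x` and `y` in `A`, the coefficients of `yx` and `x`
vanish. -/
theorem coeff_eq_zero {k : Type*} [Field k] {q a b c : k}
    (h : a • (Ay k q * Ax k q) + b • Ax k q + c • Ay k q = 0) : a = 0 ∧ b = 0 := by
  have h' := congrArg (regA k q) h
  simp only [map_add, map_smul, map_mul, regA_Ax, regA_Ay, map_zero] at h'
  have h3 := congrFun (congrFun h' 3) 0
  have h1 := congrFun (congrFun h' 1) 0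
  simp [regX, regY] at h3 h1
  exact ⟨h3, h1⟩

/-- A `k`-subspace of `Aⁿ` stable under `x` and `y` is an `A`-submodule. -/
theorem smul_mem_of_stable {k : Type*} [Field k] {q : k} {n : ℕ}
    (R : Submodule k (Fin n → Aalg k q))
    (hx : ∀ r ∈ R, Ax k q • r ∈ R) (hy : ∀ r ∈ R, Ay k q • r ∈ R)
    (a : Aalg k q) : ∀ r ∈ R, a • r ∈ R := by
  obtain ⟨b, rfl⟩ := piA_surjective k q a
  obtain ⟨f, rfl⟩ := RingQuot.mkAlgHom_surjective k (BRel k) b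
  induction f using FreeAlgebra.induction with
  | grade0 c =>
    intro r hr
    rw [AlgHom.commutes, AlgHom.commutes, algebraMap_smul]
    exact R.smul_mem c hr
  | grade1 i =>
    fin_cases i
    · exact hx
    · exact hy
  | mul f g hf hg =>
    intro r hr
    rw [map_mul, map_mul, mul_smul]
    exact hf _ (hg _ hr)
  | add f g hf hg =>
    intro r hr
    rw [map_add, map_add, add_smul]
    exact R.add_mem (hf _ hr) (hg _ hr)

theorem jordan_rev (k : Type*) [Field k] (n : ℕ) (l : k) (i j : Fin n) :
    jordan k n l i.rev j.rev = jordan k n l j i := by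
  have := i.isLt
  have := j.isLt
  simp only [jordan, Matrix.of_apply, Fin.val_rev]
  congr 1
  · exact propext (by omega)
  · congr 1
    exact propext (by omega)

theorem isUnit_det_jordan (k : Type*) [Field k] (n : ℕ) {l : k} (hl : l ≠ 0) :
    IsUnit (jordan k n l).det := by
  have h : (jordan k n l).BlockTriangular id := by
    intro i j hij
    have : (j : ℕ) < i := hij
    simp only [jordan, Matrix.of_apply]
    rw [if_neg (by omega), if_neg (by omega)]
  rw [Matrix.det_of_isUpperTriangular h]
  simp [jordan, hl]

/-- The embedding of `C_n(λ)` into `Aⁿ` whose image is that of right multiplication by the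
matrix `x + q⁻¹ y J_n(λ)`. -/
def jordanEmbedding (k : Type*) [Field k] (q : k) (n : ℕ) (l : k) :
    (Fin n ⊕ Fin n → k) →ₗ[k] (Fin n → Aalg k q) where
  toFun v i := v (.inl i.rev) • (Ay k q * Ax k q) + v (.inr i.rev) • Ax k q +
    (q⁻¹ * (jordan k n l *ᵥ (v ∘ Sum.inr)) i.rev) • Ay k q
  map_add' v w := by
    have : (v + w) ∘ Sum.inr = v ∘ Sum.inr + w ∘ (Sum.inr : Fin n → Fin n ⊕ Fin n) := rfl
    funext i
    simp only [this, Matrix.mulVec_add, Pi.add_apply, mul_add, add_smul]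
    abel
  map_smul' c v := by
    have : (c • v) ∘ Sum.inr = c • (v ∘ (Sum.inr : Fin n → Fin n ⊕ Fin n)) := rfl
    funext i
    simp only [this, Matrix.mulVec_smul, Pi.smul_apply, smul_add, smul_smul, smul_eq_mul,
      RingHom.id_apply]
    rw [mul_left_comm]

theorem jordanEmbedding_apply (k : Type*) [Field k] (q : k) (n : ℕ) (l : k)
    (v : Fin n ⊕ Fin n → k) (i : Fin n) :
    jordanEmbedding k q n l v i =
      v (.inl i.rev) • (Ay k q * Ax k q) + v (.inr i.rev) • Ax k q +
        (q⁻¹ * (jordan k n l *ᵥ (v ∘ Sum.inr)) i.rev) • Ay k q := rfl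

theorem jordanEmbedding_injective (k : Type*) [Field k] (q : k) (n : ℕ) (l : k) :
    Function.Injective (jordanEmbedding k q n l) := by
  rw [← LinearMap.ker_eq_bot, LinearMap.ker_eq_bot']
  intro v hv
  funext s
  have h i := coeff_eq_zero (congrFun hv i)
  rcases s with i | i
  · simpa using (h i.rev).1
  · simpa using (h i.rev).2

theorem jordanEmbedding_x (k : Type*) [Field k] {q : k} (hq : q ≠ 0) (n : ℕ) (l : k)
    (v : Fin n ⊕ Fin n → k) :
    jordanEmbedding k q n l (Matrix.fromBlocks 0 (jordan k n l) 0 0 *ᵥ v) =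
      Ax k q • jordanEmbedding k q n l v := by
  funext i
  simp only [Pi.smul_apply, jordanEmbedding_apply, smul_eq_mul, mul_add, mul_smul_comm,
    Ax_mul_Ax, ← mul_assoc, Ax_mul_Ay, smul_mul_assoc]
  simp [Matrix.fromBlocks_mulVec, mul_assoc, Ax_mul_Ax, smul_smul]
  congr 1
  field_simp

theorem jordanEmbedding_y (k : Type*) [Field k] (q : k) (n : ℕ) (l : k)
    (v : Fin n ⊕ Fin n → k) :
    jordanEmbedding k q n l (Matrix.fromBlocks 0 1 0 0 *ᵥ v) =
      Ay k q • jordanEmbedding k q n l v := by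
  funext i
  simp only [Pi.smul_apply, jordanEmbedding_apply, smul_eq_mul, mul_add, mul_smul_comm,
    ← mul_assoc, Ay_mul_Ay]
  simp [Matrix.fromBlocks_mulVec]

/-- The entries of the reduction of `x + q⁻¹ y J_n(λ)` modulo `w`. -/
theorem map_piA_apply (k : Type*) [Field k] (q : k) (n : ℕ) (l : k) (i j : Fin n) :
    (Bx k • (1 : Matrix (Fin n) (Fin n) (B k)) +
      (q⁻¹ • By k) • matB k (jordan k n l)).map (piA k q) i j =
      (if i = j then (1 : k) else 0) • Ax k q + (q⁻¹ * jordan k n l i j) • Ay k q := by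
  have h : (q⁻¹ • By k) * algebraMap k (B k) (jordan k n l i j) =
      (q⁻¹ * jordan k n l i j) • By k := by
    rw [← Algebra.commutes, ← Algebra.smul_def, smul_smul, mul_comm]
  simp only [Matrix.map_apply, Matrix.add_apply, Matrix.smul_apply, matB, smul_eq_mul, h,
    map_add, map_smul, Matrix.one_apply]
  split_ifs <;> simp [Ax, Ay]

theorem imageM_eq_range_jordanEmbedding (k : Type*) [Field k] {q : k} (hq : q ≠ 0) (n : ℕ) (l : k) :
    imageM k q ((Bx k • (1 : Matrix (Fin n) (Fin n) (B k)) +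
      (q⁻¹ • By k) • matB k (jordan k n l)).map (piA k q)) =
      LinearMap.range (jordanEmbedding k q n l) := by
  apply le_antisymm
  · refine Submodule.span_le.2 ?_
    rintro _ ⟨u, rfl⟩
    rw [SetLike.mem_coe]
    beta_reduce
    rw [Matrix.vecMul_eq_sum]
    refine Submodule.sum_mem _ fun i _ => ?_
    refine smul_mem_of_stable _ ?_ ?_ _ _ ?_
    · rintro _ ⟨v, rfl⟩
      exact ⟨_, jordanEmbedding_x k hq n l v⟩
    · rintro _ ⟨v, rfl⟩
      exact ⟨_, jordanEmbedding_y k q n l v⟩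
    · refine ⟨Sum.elim 0 (Pi.single i.rev 1), ?_⟩
      funext j
      rw [map_piA_apply, jordanEmbedding_apply, Sum.elim_comp_inr, Matrix.mulVec_single_one,
        Matrix.col_apply, jordan_rev]
      simp [Pi.single_apply, eq_comm]
  · rintro _ ⟨v, rfl⟩
    refine Submodule.subset_span
      ⟨fun i => v (.inl i.rev) • Ay k q + v (.inr i.rev) • 1, ?_⟩
    funext j
    simp only [Matrix.vecMul, dotProduct, map_piA_apply, jordanEmbedding_apply, Matrix.mulVec]
    simp only [add_mul, mul_add, smul_mul_assoc, mul_smul_comm, one_mul, Ay_mul_Ay, smul_zero,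
      zero_add, mul_ite, mul_zero, Finset.sum_add_distrib, ite_smul, one_smul, zero_smul,
      Finset.sum_ite_eq', Finset.mem_univ, if_true, smul_smul]
    rw [← Finset.sum_smul]
    congr 2
    rw [← Equiv.sum_comp Fin.revPerm, Finset.mul_sum]
    refine Finset.sum_congr rfl fun i _ => ?_
    rw [← jordan_rev]
    simp [mul_assoc]

theorem matB_mul (k : Type*) [Field k] {r : ℕ} (M N : Matrix (Fin r) (Fin r) k) :
    matB k M * matB k N = matB k (M * N) :=
  (Matrix.map_mul (f := algebraMap k (B k))).symm

theorem matB_one (k : Type*) [Field k] {r : ℕ} : matB k (1 : Matrix (Fin r) (Fin r) k) = 1 :=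
  Matrix.map_one _ (map_zero _) (map_one _)

theorem smul_matB_mul_smul_matB (k : Type*) [Field k] {r : ℕ} (a b : B k)
    (M N : Matrix (Fin r) (Fin r) k) :
    (a • matB k M) * (b • matB k N) = (a * b) • matB k (M * N) := by
  have h : matB k M * (b • matB k N) = b • (matB k M * matB k N) := by
    ext i j
    simp only [Matrix.mul_apply, Matrix.smul_apply, smul_eq_mul, Finset.mul_sum, matB,
      Matrix.map_apply]
    refine Finset.sum_congr rfl fun s _ => ?_
    rw [← mul_assoc, Algebra.commutes, mul_assoc]
  rw [Matrix.smul_mul, h, smul_smul, matB_mul]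

theorem map_smul_matB (k : Type*) [Field k] {r : ℕ} (ν : B k ≃ₐ[k] B k) (a : B k)
    (M : Matrix (Fin r) (Fin r) k) : (a • matB k M).map ν = ν a • matB k M := by
  ext i j
  simp [matB]

theorem stmt14 (k : Type*) [Field k] [IsAlgClosed k] (q : k) (hq : q ≠ 0)
    (ν : B k ≃ₐ[k] B k)
    (hνx : ν (Bx k) = -(q⁻¹ • Bx k)) (hνy : ν (By k) = -(q • By k))
    (n : ℕ) (hn : 1 ≤ n) (l : k) (hl : l ≠ 0) :
    (Bx k • (1 : Matrix (Fin n) (Fin n) (B k)) +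
          (q⁻¹ • By k) • matB k (jordan k n l)).map ⇑ν *
        ((q • Bx k) • matB k (jordan k n l)⁻¹ - (q • By k) • (1 : Matrix (Fin n) (Fin n) (B k))) =
      wB k q • (1 : Matrix (Fin n) (Fin n) (B k)) ∧
    ((q • Bx k) • matB k (jordan k n l)⁻¹ - (q • By k) • (1 : Matrix (Fin n) (Fin n) (B k))) *
        (Bx k • (1 : Matrix (Fin n) (Fin n) (B k)) + (q⁻¹ • By k) • matB k (jordan k n l)) =
      wB k q • (1 : Matrix (Fin n) (Fin n) (B k)) ∧
    ∃ e : (Fin n ⊕ Fin n → k) ≃ₗ[k]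
        imageM k q ((Bx k • (1 : Matrix (Fin n) (Fin n) (B k)) +
          (q⁻¹ • By k) • matB k (jordan k n l)).map ⇑(piA k q)),
      (∀ v : Fin n ⊕ Fin n → k,
        (e (Matrix.fromBlocks 0 (jordan k n l) 0 0 *ᵥ v) : Fin n → Aalg k q) =
          Ax k q • (e v : Fin n → Aalg k q)) ∧
      (∀ v : Fin n ⊕ Fin n → k,
        (e (Matrix.fromBlocks 0 1 0 0 *ᵥ v) : Fin n → Aalg k q) =
          Ay k q • (e v : Fin n → Aalg k q)) := by
  have hJ := isUnit_det_jordan k n hl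
  refine ⟨?_, ?_, ?_⟩
  · rw [Matrix.map_add _ (map_add ν), ← matB_one k, map_smul_matB, map_smul_matB, map_smul, hνx,
      hνy, add_mul, mul_sub, mul_sub]
    simp only [smul_matB_mul_smul_matB, Matrix.mul_nonsing_inv _ hJ, mul_one, one_mul]
    simp [Bx_mul_Bx, By_mul_By, smul_smul, hq, wB, matB_one, sub_eq_add_neg, add_smul]
  · rw [← matB_one k, sub_mul, mul_add, mul_add]
    simp only [smul_matB_mul_smul_matB, Matrix.nonsing_inv_mul _ hJ, mul_one, one_mul]
    simp [Bx_mul_Bx, By_mul_By, smul_smul, hq, wB, sub_smul]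
  · rw [imageM_eq_range_jordanEmbedding k hq]
    exact ⟨LinearEquiv.ofInjective _ (jordanEmbedding_injective k q n l),
      jordanEmbedding_x k hq n l, jordanEmbedding_y k q n l⟩
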